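/- arXiv:1109.0342 — 3 statements merged into one kernel-verified Lean document; each statement's English description precedes it below -/
import Mathlib

section
/- For every i with 1 ≤ i ≤ n−1 one has in A the identity Ŝ_n · E_i = Ŝ_n · E_1 · T_2T_3⋯T_i · T_1T_2⋯T_{i−1}, where Ŝ_n = Σ_{w∈S_n} q^{ℓ(w)} T_w (for i = 1 the two products of T's are empty). -/
open Finset
open scoped Pointwise

namespace BMWPaper

/-- The Coxeter length of a permutation of `Fin n`: the number of inversions. -/
def len {n : ℕ} (w : Equiv.Perm (Fin n)) : ℕ :=
  (Finset.univ.filter (fun p : Fin n × Fin n => p.1 < p.2 ∧ w p.2 < w p.1)).card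

/-- `sGen n i` is the adjacent transposition `s_i = (i, i+1)` (1-based) in `S_n`;
it is the identity for out-of-range `i`. -/
def sGen (n i : ℕ) : Equiv.Perm (Fin n) :=
  if h : 1 ≤ i ∧ i < n then Equiv.swap ⟨i - 1, by omega⟩ ⟨i, h.2⟩ else 1

/-- `pimg d i` is the (1-based) image `(i)d` of the point `i ∈ {1,…,n}` under the
*right* action of the permutation `d` (permutations act on points on the right,
so that `(a)(στ) = ((a)σ)τ` for the group multiplication `σ * τ`);
the junk value `0` is returned for out-of-range `i`. -/
def pimg {n : ℕ} (d : Equiv.Perm (Fin n)) (i : ℕ) : ℕ :=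
  if h : i - 1 < n then ((d⁻¹ ⟨i - 1, h⟩ : Fin n) : ℕ) + 1 else 0

open scoped Classical in
/-- `Hset n f` is the set `H_f(n)` of all `d ∈ S_n` such that
`(1)d < (3)d < ⋯ < (2f-1)d`, `(2i-1)d < (2i)d` for `i = 1,…,f`, and
`(2f+1)d < (2f+2)d < ⋯ < (n)d`. -/
noncomputable def Hset (n f : ℕ) : Finset (Equiv.Perm (Fin n)) :=
  Finset.univ.filter (fun d =>
    (∀ i ∈ Finset.Icc 1 (f - 1), pimg d (2 * i - 1) < pimg d (2 * i + 1)) ∧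
    (∀ i ∈ Finset.Icc 1 f, pimg d (2 * i - 1) < pimg d (2 * i)) ∧
    (∀ j ∈ Finset.Icc (2 * f + 1) (n - 1), pimg d j < pimg d (j + 1)))

/-- The index of the block of the composition `μ` containing the (0-based) point `k`. -/
def blockOf (μ : List ℕ) (k : ℕ) : ℕ :=
  ((List.range μ.length).filter (fun j => (μ.take (j + 1)).sum ≤ k)).length

open scoped Classical in
/-- The Young subgroup `S_μ` of `S_n` associated with a composition `μ` of `n`,
as the set of permutations preserving each of the consecutive blocks of `μ`. -/
noncomputable def youngSet (n : ℕ) (μ : List ℕ) : Finset (Equiv.Perm (Fin n)) :=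
  Finset.univ.filter (fun w => ∀ a : Fin n, blockOf μ ((w a : ℕ)) = blockOf μ (a : ℕ))

open scoped Classical in
/-- The set `D_μ` of minimal-length right coset representatives of `S_μ` in `S_n`:
the elements of minimal length in their right coset `S_μ d`. -/
noncomputable def Dset (n : ℕ) (μ : List ℕ) : Finset (Equiv.Perm (Fin n)) :=
  Finset.univ.filter (fun d => ∀ u ∈ youngSet n μ, len d ≤ len (u * d))

/-- The identification of `Fin m` with the block `[k, k+m)` of `Fin n` (0-based). -/
def shiftEquiv (n k m : ℕ) (h : k + m ≤ n) :
    Fin m ≃ {a : Fin n // k ≤ (a : ℕ) ∧ (a : ℕ) < k + m} where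
  toFun b := ⟨⟨k + (b : ℕ), by have := b.isLt; omega⟩, by
    constructor
    · exact Nat.le_add_right _ _
    · have := b.isLt; simp only [Fin.val_mk]; omega⟩
  invFun a := ⟨(a : Fin n) - k, by have := a.2; omega⟩
  left_inv b := by
    apply Fin.ext
    simp
  right_inv a := by
    apply Subtype.ext
    apply Fin.ext
    have := a.2
    simp only []
    omega

open scoped Classical in
/-- The embedding of `S_m` into `S_n` as the group of permutations of the
(1-based) block `{k+1, …, k+m}` of `{1, …, n}`. -/
noncomputable def shiftEmb (n k m : ℕ) (w : Equiv.Perm (Fin m)) : Equiv.Perm (Fin n) :=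
  if h : k + m ≤ n then w.extendDomain (shiftEquiv n k m h) else 1

open scoped Classical in
/-- The subgroup of `S_n` of permutations fixing the (1-based) points `1, …, k`. -/
noncomputable def fixSet (n k : ℕ) : Finset (Equiv.Perm (Fin n)) :=
  Finset.univ.filter (fun w => ∀ a : Fin n, (a : ℕ) < k → w a = a)


/-- `bbs n i` is the permutation `𝕤_i = s_{2i} s_{2i-1} s_{2i+1} s_{2i} = (2i-1, 2i+1)(2i, 2i+2)`. -/
def bbs (n i : ℕ) : Equiv.Perm (Fin n) :=
  sGen n (2 * i) * sGen n (2 * i - 1) * sGen n (2 * i + 1) * sGen n (2 * i)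

open scoped Classical in
/-- The set `𝔻_{(1,f-1)} = {𝕤_1 𝕤_2 ⋯ 𝕤_k : k = 0, …, f-1}` in `S_{2f}`. -/
noncomputable def bbD1 (f : ℕ) : Finset (Equiv.Perm (Fin (2 * f))) :=
  (Finset.range f).image (fun k => ((List.range k).map (fun j => bbs (2 * f) (j + 1))).prod)

open scoped Classical in
/-- The set `𝔻_{(1,f-2)}^{{2,…,f}} = {𝕤_2 𝕤_3 ⋯ 𝕤_k : k = 1, …, f-1}` in `S_{2f}`. -/
noncomputable def bbD1' (f : ℕ) : Finset (Equiv.Perm (Fin (2 * f))) :=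
  (Finset.Icc 1 (f - 1)).image
    (fun k => ((List.range (k - 1)).map (fun j => bbs (2 * f) (j + 2))).prod)

open scoped Classical in
/-- `H_f^{(a)} = {d ∈ H_f(n) : (1)d⁻¹ = 1, (2)d⁻¹ = 2}`. -/
noncomputable def HsetA (n f : ℕ) : Finset (Equiv.Perm (Fin n)) :=
  (Hset n f).filter (fun d => pimg d⁻¹ 1 = 1 ∧ pimg d⁻¹ 2 = 2)

open scoped Classical in
/-- `H_f^{(b)} = {d ∈ H_f(n) : (1)d⁻¹ = 1, (2)d⁻¹ = 3}`. -/
noncomputable def HsetB (n f : ℕ) : Finset (Equiv.Perm (Fin n)) :=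
  (Hset n f).filter (fun d => pimg d⁻¹ 1 = 1 ∧ pimg d⁻¹ 2 = 3)

open scoped Classical in
/-- `H_f^{(c)} = {d ∈ H_f(n) : (1)d⁻¹ = 1, (2)d⁻¹ = 2f+1}`. -/
noncomputable def HsetC (n f : ℕ) : Finset (Equiv.Perm (Fin n)) :=
  (Hset n f).filter (fun d => pimg d⁻¹ 1 = 1 ∧ pimg d⁻¹ 2 = 2 * f + 1)

open scoped Classical in
/-- `H_f^{(d)} = {d ∈ H_f(n) : (1)d⁻¹ = 2f+1, (2)d⁻¹ = 1}`. -/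
noncomputable def HsetD (n f : ℕ) : Finset (Equiv.Perm (Fin n)) :=
  (Hset n f).filter (fun d => pimg d⁻¹ 1 = 2 * f + 1 ∧ pimg d⁻¹ 2 = 1)

open scoped Classical in
/-- `H_f^{(e)} = {d ∈ H_f(n) : (1)d⁻¹ = 2f+1, (2)d⁻¹ = 2f+2}`. -/
noncomputable def HsetE (n f : ℕ) : Finset (Equiv.Perm (Fin n)) :=
  (Hset n f).filter (fun d => pimg d⁻¹ 1 = 2 * f + 1 ∧ pimg d⁻¹ 2 = 2 * f + 2)

section Algebra

variable {F : Type*} [Field F] {A : Type*} [Ring A] [Algebra F A]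

/-- For a set `S` of permutations, `hat c Tw S = Σ_{w ∈ S} c^{ℓ(w)} T_w`. -/
noncomputable def hat {n : ℕ} (c : F) (Tw : Equiv.Perm (Fin n) → A)
    (S : Finset (Equiv.Perm (Fin n))) : A :=
  ∑ w ∈ S, c ^ len w • Tw w

/-- `Ehat E f = E_1 E_3 ⋯ E_{2f-1}`. -/
def Ehat (E : ℕ → A) (f : ℕ) : A := ((List.range f).map (fun i => E (2 * i + 1))).prod

/-- `Tprod T a b = T_a T_{a+1} ⋯ T_b` (the empty product `1` if `b < a`). -/
def Tprod (T : ℕ → A) (a b : ℕ) : A := ((List.range (b + 1 - a)).map (fun t => T (a + t))).prod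

/-- `sDesc n a b = s_a s_{a-1} ⋯ s_b` (descending product of adjacent transpositions). -/
def sDesc (n a b : ℕ) : Equiv.Perm (Fin n) :=
  ((List.range (a + 1 - b)).map (fun j => sGen n (a - j))).prod

/-- The data of a Birman–Murakami–Wenzl algebra structure: an `F`-algebra `A`
with invertible elements `T_1, …, T_{n-1}` and elements `E_1, …, E_{n-1}`
satisfying the BMW relations, together with a map `w ↦ T_w` from `S_n` to `A`
with `T_id = 1`, `T_{s_i} = T_i` and `T_{uv} = T_u T_v` whenever lengths add. -/
structure BMWData (F : Type*) [Field F] (A : Type*) [Ring A] [Algebra F A]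
    (n : ℕ) (q r : F) where
  T : ℕ → A
  Tinv : ℕ → A
  E : ℕ → A
  Tw : Equiv.Perm (Fin n) → A
  hq : q ≠ 0
  hr : r ≠ 0
  hqq : q - q⁻¹ ≠ 0
  T_mul_Tinv : ∀ i, 1 ≤ i → i ≤ n - 1 → T i * Tinv i = 1
  Tinv_mul_T : ∀ i, 1 ≤ i → i ≤ n - 1 → Tinv i * T i = 1
  skein : ∀ i, 1 ≤ i → i ≤ n - 1 → T i - Tinv i = (q - q⁻¹) • (1 - E i)
  Esq : ∀ i, 1 ≤ i → i ≤ n - 1 → E i * E i = (1 + (r - r⁻¹) / (q - q⁻¹)) • E i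
  braid : ∀ i, 1 ≤ i → i + 1 ≤ n - 1 → T i * T (i + 1) * T i = T (i + 1) * T i * T (i + 1)
  T_comm : ∀ i j, 1 ≤ i → i ≤ n - 1 → 1 ≤ j → j ≤ n - 1 → (i + 1 < j ∨ j + 1 < i) →
    T i * T j = T j * T i
  EEE₁ : ∀ i, 1 ≤ i → i + 1 ≤ n - 1 → E i * E (i + 1) * E i = E i
  EEE₂ : ∀ i, 1 ≤ i → i + 1 ≤ n - 1 → E (i + 1) * E i * E (i + 1) = E (i + 1)
  TTE₁ : ∀ i, 1 ≤ i → i + 1 ≤ n - 1 → T i * T (i + 1) * E i = E (i + 1) * E i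
  TTE₂ : ∀ i, 1 ≤ i → i + 1 ≤ n - 1 → T (i + 1) * T i * E (i + 1) = E i * E (i + 1)
  ET : ∀ i, 1 ≤ i → i ≤ n - 1 → E i * T i = r⁻¹ • E i
  TE : ∀ i, 1 ≤ i → i ≤ n - 1 → T i * E i = r⁻¹ • E i
  ETE₁ : ∀ i, 1 ≤ i → i + 1 ≤ n - 1 → E i * T (i + 1) * E i = r • E i
  ETE₂ : ∀ i, 1 ≤ i → i + 1 ≤ n - 1 → E (i + 1) * T i * E (i + 1) = r • E (i + 1)
  Tw_one : Tw 1 = 1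
  Tw_s : ∀ i, 1 ≤ i → i ≤ n - 1 → Tw (sGen n i) = T i
  Tw_mul : ∀ u v : Equiv.Perm (Fin n), len (u * v) = len u + len v →
    Tw (u * v) = Tw u * Tw v

/-- The scalars `a_f` defined by `a_0 = 1` and `a_i = a_{i-1} · Σ_{k=0}^{i-1} q^{2k}`. -/
noncomputable def aseq (q : F) : ℕ → F
  | 0 => 1
  | (i + 1) => aseq q i * (∑ k ∈ Finset.range (i + 1), q ^ (2 * k))


/-- The scalars `c_f` defined by `c_0 = 1` and
`c_f = -((q^{4f-3} - q^{2f-3})/(r q^{2n-2f-2} - q⁻¹)) · c_{f-1}`. -/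
noncomputable def cseq (q r : F) (n : ℕ) : ℕ → F
  | 0 => 1
  | (f + 1) =>
      -((q ^ (4 * ((f : ℤ) + 1) - 3) - q ^ (2 * ((f : ℤ) + 1) - 3)) /
          (r * q ^ (2 * (n : ℤ) - 2 * ((f : ℤ) + 1) - 2) - q⁻¹)) * cseq q r n f

/-- The scalars `č_f` defined by `č_0 = 1` and
`č_f = (q^{3-4f}(1 - q^{2f})/(q + r q^{2+2f-2n})) · č_{f-1}` (with integer exponents). -/
noncomputable def ccseq (q r : F) (n : ℕ) : ℕ → F
  | 0 => 1
  | (f + 1) =>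
      (q ^ ((3 : ℤ) - 4 * ((f : ℤ) + 1)) * (1 - q ^ (2 * (f + 1))) /
          (q + r * q ^ ((2 : ℤ) + 2 * ((f : ℤ) + 1) - 2 * (n : ℤ)))) * ccseq q r n f

/-- The element `x_f = (H_f⁻¹)^ · Ŝ_{{2f+1,…,n}} · Ê_f · Ĥ_f` of the BMW algebra. -/
noncomputable def xEl {F : Type*} [Field F] {A : Type*} [Ring A] [Algebra F A]
    {n : ℕ} {q r : F} (D : BMWData F A n q r) (f : ℕ) : A :=
  hat q D.Tw ((Hset n f).image (fun d => d⁻¹)) * hat q D.Tw (fixSet n (2 * f)) *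
    Ehat D.E f * hat q D.Tw (Hset n f)

/-- The element `x̌_f = (H_f⁻¹)ˇ · Š_{{2f+1,…,n}} · Ê_f · Ȟ_f` of the BMW algebra,
where `ˇ` is formed with `-q⁻¹` in place of `q`. -/
noncomputable def xElCheck {F : Type*} [Field F] {A : Type*} [Ring A] [Algebra F A]
    {n : ℕ} {q r : F} (D : BMWData F A n q r) (f : ℕ) : A :=
  hat (-q⁻¹) D.Tw ((Hset n f).image (fun d => d⁻¹)) * hat (-q⁻¹) D.Tw (fixSet n (2 * f)) *
    Ehat D.E f * hat (-q⁻¹) D.Tw (Hset n f)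

end Algebra

section Length

variable {n : ℕ}

/-- The adjacent transposition of positions `a, a + 1` preserves the order of all other pairs. -/
lemma swap_lt_swap_iff {a b x y : Fin n} (hab : (b : ℕ) = a + 1) (h : ¬(x = a ∧ y = b))
    (h' : ¬(x = b ∧ y = a)) : Equiv.swap a b x < Equiv.swap a b y ↔ x < y := by
  simp only [Equiv.swap_apply_def, Fin.ext_iff, Fin.lt_def] at *
  split_ifs <;> omega

lemma len_one : len (1 : Equiv.Perm (Fin n)) = 0 := by
  rw [len, Finset.card_eq_zero, Finset.filter_eq_empty_iff]
  rintro p - ⟨h₁, h₂⟩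
  exact lt_asymm h₁ h₂

lemma len_mul_swap {w : Equiv.Perm (Fin n)} {a b : Fin n} (hab : (b : ℕ) = a + 1)
    (hw : w a < w b) : len (w * Equiv.swap a b) = len w + 1 := by
  have hlt : a < b := by rw [Fin.lt_def]; omega
  let e : Fin n × Fin n ≃ Fin n × Fin n := (Equiv.swap a b).prodCongr (Equiv.swap a b)
  have key : (univ.filter fun p : Fin n × Fin n =>
        p.1 < p.2 ∧ (w * Equiv.swap a b) p.2 < (w * Equiv.swap a b) p.1) =
      insert (a, b) ((univ.filter fun p : Fin n × Fin n =>
        p.1 < p.2 ∧ w p.2 < w p.1).map e.toEmbedding) := by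
    ext ⟨x, y⟩
    simp only [mem_filter, mem_univ, true_and, mem_insert, mem_map_equiv, Prod.mk.injEq]
    change x < y ∧ w (Equiv.swap a b y) < w (Equiv.swap a b x) ↔ _ ∨ (Equiv.swap a b x < Equiv.swap a b y ∧
      w (Equiv.swap a b y) < w (Equiv.swap a b x))
    by_cases h : x = a ∧ y = b
    · obtain ⟨rfl, rfl⟩ := h
      simp [hlt, hw]
    by_cases h' : x = b ∧ y = a
    · obtain ⟨rfl, rfl⟩ := h'
      simp [hlt.ne', hw.not_gt]
    · simp [h, swap_lt_swap_iff hab h h']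
  rw [len, key, card_insert_of_notMem, card_map, len]
  simp only [mem_map_equiv, mem_filter, mem_univ, true_and]
  change ¬(Equiv.swap a b a < Equiv.swap a b b ∧ _)
  simp [hlt.not_gt]

lemma sGen_eq_swap {i : ℕ} {a b : Fin n} (ha : (a : ℕ) + 1 = i) (hb : (b : ℕ) = i) :
    sGen n i = Equiv.swap a b := by
  subst hb
  rw [sGen, dif_pos ⟨by omega, b.isLt⟩]
  congr 1
  ext
  simp only [← ha]
  omega

end Length

lemma Tprod_succ {A : Type*} [Ring A] (T : ℕ → A) {a b : ℕ} (h : a ≤ b + 1) :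
    Tprod T a (b + 1) = Tprod T a b * T (b + 1) := by
  rw [Tprod, Tprod, show b + 1 + 1 - a = b + 1 - a + 1 by omega, List.range_succ, List.map_append,
    List.prod_append]
  simp [show a + (b + 1 - a) = b + 1 by omega]

namespace BMWData

variable {F : Type*} [Field F] {A : Type*} [Ring A] [Algebra F A] {n : ℕ} {q r : F}
  (D : BMWData F A n q r) {i : ℕ}

lemma T_mul_T_self (h1 : 1 ≤ i) (h2 : i ≤ n - 1) :
    D.T i * D.T i = 1 + (q - q⁻¹) • D.T i - ((q - q⁻¹) * r⁻¹) • D.E i := by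
  have h := congrArg (D.T i * ·) (D.skein i h1 h2)
  simp only [mul_sub, mul_smul_comm, D.T_mul_Tinv i h1 h2, D.TE i h1 h2, mul_one, smul_sub,
    sub_eq_iff_eq_add] at h
  rw [h]
  module

lemma E_mul_T_mul_T (h1 : 1 ≤ i) (h2 : i + 1 ≤ n - 1) :
    D.E i * D.T (i + 1) * D.T i = D.T (i + 1) * D.T i * D.E (i + 1) := by
  have h2' : i ≤ n - 1 := by omega
  have hinv : D.Tinv i * (D.T (i + 1) * D.T i) = D.T (i + 1) * D.T i * D.Tinv (i + 1) :=
    calc D.Tinv i * (D.T (i + 1) * D.T i)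
        = D.Tinv i * (D.T (i + 1) * D.T i * D.T (i + 1)) * D.Tinv (i + 1) := by
          simp only [mul_assoc, D.T_mul_Tinv (i + 1) (by omega) h2, mul_one]
      _ = (D.Tinv i * D.T i) * (D.T (i + 1) * D.T i) * D.Tinv (i + 1) := by
          rw [← D.braid i h1 h2]; simp only [mul_assoc]
      _ = _ := by rw [D.Tinv_mul_T i h1 h2', one_mul]
  have hsub : (D.T i - D.Tinv i) * (D.T (i + 1) * D.T i) =
      D.T (i + 1) * D.T i * (D.T (i + 1) - D.Tinv (i + 1)) := by
    rw [sub_mul, mul_sub, hinv, ← mul_assoc, D.braid i h1 h2]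
  rw [D.skein i h1 h2', D.skein (i + 1) (by omega) h2, smul_mul_assoc, mul_smul_comm] at hsub
  have h := smul_right_injective A D.hqq hsub
  rw [sub_mul, mul_sub, one_mul, mul_one, sub_right_inj, ← mul_assoc] at h
  exact h

lemma T_succ_mul_E_mul_E (h1 : 1 ≤ i) (h2 : i + 1 ≤ n - 1) :
    D.T (i + 1) * (D.E i * D.E (i + 1)) =
      D.T i * D.E (i + 1) + (q - q⁻¹) • (D.E i * D.E (i + 1)) - (q - q⁻¹) • D.E (i + 1) := by
  rw [← D.TTE₂ i h1 h2, mul_assoc, ← mul_assoc, D.T_mul_T_self (by omega) h2, sub_mul, add_mul,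
    one_mul, smul_mul_assoc, smul_mul_assoc, ← mul_assoc, ← mul_assoc, D.ETE₂ i h1 h2, smul_smul,
    inv_mul_cancel_right₀ D.hr]

/-- The symmetrizer of the parabolic subgroup generated by `s_i, s_{i+1}`. -/
noncomputable def symmetrizer₃ (i : ℕ) : A :=
  1 + q • D.T i + q • D.T (i + 1) + q ^ 2 • (D.T i * D.T (i + 1)) +
    q ^ 2 • (D.T (i + 1) * D.T i) + q ^ 3 • (D.T i * D.T (i + 1) * D.T i)

lemma symmetrizer₃_mul_E (h1 : 1 ≤ i) (h2 : i + 1 ≤ n - 1) :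
    D.symmetrizer₃ i * D.E (i + 1) = D.symmetrizer₃ i * (D.E i * D.E (i + 1)) := by
  have hq := D.hq
  have h2' : i ≤ n - 1 := by omega
  have e₁ : D.T (i + 1) * D.E (i + 1) = r⁻¹ • D.E (i + 1) := D.TE (i + 1) (by omega) h2
  have e₂ : D.T (i + 1) * (D.T i * D.E (i + 1)) = D.E i * D.E (i + 1) := by
    rw [← mul_assoc, D.TTE₂ i h1 h2]
  have e₃ : D.T i * (D.E i * D.E (i + 1)) = r⁻¹ • (D.E i * D.E (i + 1)) := by
    rw [← mul_assoc, D.TE i h1 h2', smul_mul_assoc]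
  have e₄ : D.T i * (D.T (i + 1) * (D.E i * D.E (i + 1))) = D.E (i + 1) := by
    rw [← mul_assoc, ← mul_assoc, D.TTE₁ i h1 h2, D.EEE₂ i h1 h2]
  simp only [symmetrizer₃, add_mul, one_mul, smul_mul_assoc, mul_assoc, e₁, e₂, e₃, e₄,
    mul_smul_comm]
  rw [D.T_succ_mul_E_mul_E h1 h2]
  match_scalars <;> field_simp <;> ring

lemma Tw_mul_sGen {w : Equiv.Perm (Fin n)} (h1 : 1 ≤ i) (h2 : i ≤ n - 1) {a b : Fin n}
    (ha : (a : ℕ) + 1 = i) (hb : (b : ℕ) = i) (hw : w a < w b) :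
    q ^ len (w * Equiv.swap a b) • D.Tw (w * Equiv.swap a b) =
      (q ^ len w • D.Tw w) * (q • D.T i) := by
  have hab : (b : ℕ) = a + 1 := by omega
  have hl := len_mul_swap hab hw
  have hs : len (Equiv.swap a b) = 1 := by
    have := len_mul_swap (w := 1) hab (by simp only [Equiv.Perm.one_apply, Fin.lt_def]; omega)
    rwa [one_mul, len_one] at this
  rw [D.Tw_mul _ _ (by rw [hl, hs]), hl, ← sGen_eq_swap ha hb, D.Tw_s i h1 h2, pow_succ,
    smul_mul_smul_comm]

lemma hat_filter_mul_swap (h1 : 1 ≤ i) (h2 : i ≤ n - 1) {a b : Fin n}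
    (ha : (a : ℕ) + 1 = i) (hb : (b : ℕ) = i) (p p' : Equiv.Perm (Fin n) → Prop)
    [DecidablePred p] [DecidablePred p'] (hp : ∀ w, p w → w a < w b)
    (hp' : ∀ w, p' w ↔ p (w * Equiv.swap a b)) :
    hat q D.Tw (univ.filter p') =
      hat q D.Tw (univ.filter p) * (q • D.T i) := by
  rw [hat, hat, sum_mul]
  symm
  refine sum_equiv (Equiv.mulRight (Equiv.swap a b)) (fun w => ?_) fun w hw => ?_
  · simp [hp', mul_assoc]
  · exact (D.Tw_mul_sGen h1 h2 ha hb (hp w (by simpa using hw))).symm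

/-- The symmetrizer of `S_n` is a left multiple of the symmetrizer of `⟨s_i, s_{i+1}⟩`. -/
lemma exists_hat_univ_eq_mul (h1 : 1 ≤ i) (h2 : i + 1 ≤ n - 1) :
    ∃ Z, hat q D.Tw univ = Z * D.symmetrizer₃ i := by
  let a : Fin n := ⟨i - 1, by omega⟩
  let b : Fin n := ⟨i, by omega⟩
  let c : Fin n := ⟨i + 1, by omega⟩
  have hab : a ≠ b := by simp only [a, b, ne_eq, Fin.ext_iff]; omega
  have hac : a ≠ c := by simp only [a, c, ne_eq, Fin.ext_iff]; omega
  have hbc : b ≠ c := by simp only [b, c, ne_eq, Fin.ext_iff]; omega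
  let C (x y z : Fin n) : A := hat q D.Tw (univ.filter fun w => w x < w y ∧ w y < w z)
  have sa₁ : Equiv.swap a b c = c := Equiv.swap_apply_of_ne_of_ne hac.symm hbc.symm
  have sa₂ : Equiv.swap b c a = a := Equiv.swap_apply_of_ne_of_ne hab hac
  have step₁ (x y z : Fin n) (h : ∀ w : Equiv.Perm (Fin n), w x < w y ∧ w y < w z → w a < w b) :
      C (Equiv.swap a b x) (Equiv.swap a b y) (Equiv.swap a b z) = C x y z * (q • D.T i) :=
    D.hat_filter_mul_swap h1 (by omega) (by simp only [a]; omega) rfl _ _ h fun _ => Iff.rfl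
  have step₂ (x y z : Fin n) (h : ∀ w : Equiv.Perm (Fin n), w x < w y ∧ w y < w z → w b < w c) :
      C (Equiv.swap b c x) (Equiv.swap b c y) (Equiv.swap b c z) = C x y z * (q • D.T (i + 1)) :=
    D.hat_filter_mul_swap (by omega) h2 rfl rfl _ _ h fun _ => Iff.rfl
  have c₁ := step₁ a b c fun w h => h.1
  have c₂ := step₂ a b c fun w h => h.2
  have c₃ := step₂ b a c fun w h => h.1.trans h.2
  have c₄ := step₁ a c b fun w h => h.1.trans h.2
  have c₅ := step₁ c a b fun w h => h.2
  simp only [Equiv.swap_apply_left, Equiv.swap_apply_right, sa₁, sa₂] at c₁ c₂ c₃ c₄ c₅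
  have total : hat q D.Tw univ = C a b c + C b a c + C a c b + C c a b + C b c a + C c b a := by
    simp only [C, hat, sum_filter, ← sum_add_distrib]
    refine sum_congr rfl fun w _ => ?_
    have h₁ : w a ≠ w b := w.injective.ne hab
    have h₂ : w a ≠ w c := w.injective.ne hac
    have h₃ : w b ≠ w c := w.injective.ne hbc
    rcases h₁.lt_or_gt with h₁ | h₁ <;> rcases h₂.lt_or_gt with h₂ | h₂ <;>
      rcases h₃.lt_or_gt with h₃ | h₃ <;>
      first
        | exact absurd (h₁.trans (h₃.trans h₂)) (lt_irrefl _)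
        | exact absurd (h₂.trans (h₃.trans h₁)) (lt_irrefl _)
        | simp [h₁, h₂, h₃, h₁.not_gt, h₂.not_gt, h₃.not_gt]
  refine ⟨C a b c, ?_⟩
  rw [total, c₅, c₄, c₃, c₂, c₁, symmetrizer₃]
  simp only [mul_add, mul_one, mul_smul_comm, smul_mul_assoc, mul_assoc, smul_smul]
  module

lemma hat_univ_mul_E_succ (h1 : 1 ≤ i) (h2 : i + 1 ≤ n - 1) :
    hat q D.Tw univ * D.E (i + 1) = hat q D.Tw univ * D.E i * (D.T (i + 1) * D.T i) := by
  obtain ⟨Z, hZ⟩ := D.exists_hat_univ_eq_mul h1 h2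
  rw [hZ, mul_assoc, D.symmetrizer₃_mul_E h1 h2, ← D.TTE₂ i h1 h2, ← D.E_mul_T_mul_T h1 h2]
  simp only [mul_assoc]

lemma commute_T_Tprod {m : ℕ} (hm : m + 1 < i) (h2 : i ≤ n - 1) :
    Commute (D.T i) (Tprod D.T 1 m) := by
  induction m with
  | zero => exact Commute.one_right _
  | succ m ih =>
    rw [Tprod_succ _ (by omega)]
    exact (ih (by omega)).mul_right
      (D.T_comm i (m + 1) (by omega) h2 (by omega) (by omega) (.inr hm))

end BMWData

/-- For `1 ≤ i ≤ n-1`,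
`Ŝ_n · E_i = Ŝ_n · E_1 · T_2 T_3 ⋯ T_i · T_1 T_2 ⋯ T_{i-1}`. -/
theorem statement2 {F : Type*} [Field F] {A : Type*} [Ring A] [Algebra F A]
    {n : ℕ} (hn : 1 ≤ n) {q r : F} (D : BMWData F A n q r)
    (i : ℕ) (h1 : 1 ≤ i) (h2 : i ≤ n - 1) :
    hat q D.Tw (Finset.univ : Finset (Equiv.Perm (Fin n))) * D.E i =
      hat q D.Tw (Finset.univ : Finset (Equiv.Perm (Fin n))) * D.E 1 *
        Tprod D.T 2 i * Tprod D.T 1 (i - 1) := by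
  induction i, h1 using Nat.le_induction with
  | base => simp [Tprod]
  | succ i h1 ih =>
    obtain ⟨m, rfl⟩ := Nat.exists_eq_add_of_le' h1
    rw [D.hat_univ_mul_E_succ h1 h2, ih (by omega),
      Tprod_succ _ (a := 2) (b := m + 1) (by omega),
      Nat.add_sub_cancel, Nat.add_sub_cancel, Tprod_succ _ (a := 1) (by omega)]
    have h := (D.commute_T_Tprod (m := m) (i := m + 1 + 1) (by omega) h2).eq
    simp only [mul_assoc]
    rw [← mul_assoc (D.T (m + 1 + 1)), h, mul_assoc]

end BMWPaper
end

section
/- Assume n ≥ 2 and r + q ≠ 0. Then in A one has Ŝ_n · D̂_{(1,n−1)} = (Σ_{i=0}^{n−1} q^{2i}) · Ŝ_n + ((1 − q²)/(q⁻¹r + 1)) · Ŝ_n · E_1 · D̂_{(2,n−2)}, where D_{(1,n−1)} = {s_1s_2⋯s_{i−1} : i = 1,…,n} and D_{(2,n−2)} = {s_2s_3⋯s_{i−1}s_1s_2⋯s_{j−1} : 1 ≤ j < i ≤ n} are the minimal-length right coset representatives of the Young subgroups S_{(1,n−1)} and S_{(2,n−2)} in S_n. -/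
open Finset
open scoped Pointwise

namespace BMWPaper

section Permutations

variable {n : ℕ}

lemma sGen_apply_val {i : ℕ} (h1 : 1 ≤ i) (h2 : i < n) (x : Fin n) :
    (sGen n i x : ℕ) = if (x : ℕ) = i - 1 then i else if (x : ℕ) = i then i - 1 else x := by
  rw [sGen, dif_pos ⟨h1, h2⟩, Equiv.swap_apply_def]
  simp only [Fin.ext_iff]
  split_ifs <;> simp_all

lemma sGen_mul_self (i : ℕ) : sGen n i * sGen n i = 1 := by
  unfold sGen
  split_ifs <;> simp

lemma sGen_inv (i : ℕ) : (sGen n i)⁻¹ = sGen n i :=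
  inv_eq_of_mul_eq_one_left (sGen_mul_self i)

lemma sGen_apply_left {i : ℕ} (h1 : 1 ≤ i) (h2 : i < n) :
    sGen n i ⟨i - 1, by omega⟩ = ⟨i, h2⟩ := by
  rw [sGen, dif_pos ⟨h1, h2⟩, Equiv.swap_apply_left]

lemma sGen_apply_right {i : ℕ} (h1 : 1 ≤ i) (h2 : i < n) :
    sGen n i ⟨i, h2⟩ = ⟨i - 1, by omega⟩ := by
  rw [sGen, dif_pos ⟨h1, h2⟩, Equiv.swap_apply_right]

lemma sGen_apply_of_ne {i : ℕ} (h1 : 1 ≤ i) (h2 : i < n) {x : Fin n}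
    (hx : (x : ℕ) ≠ i - 1) (hx' : (x : ℕ) ≠ i) : sGen n i x = x := by
  apply Fin.ext
  rw [sGen_apply_val h1 h2, if_neg hx, if_neg hx']

lemma len_inv (w : Equiv.Perm (Fin n)) : len w⁻¹ = len w := by
  refine Finset.card_bij' (fun p _ => (w⁻¹ p.2, w⁻¹ p.1)) (fun p _ => (w p.2, w p.1)) ?_ ?_ ?_ ?_
  · rintro p hp
    simpa [and_comm] using hp
  · rintro p hp
    simpa [and_comm] using hp
  · simp
  · simp

lemma len_mul_sGen (w : Equiv.Perm (Fin n)) {i : ℕ} (h1 : 1 ≤ i) (h2 : i < n)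
    (h : w ⟨i - 1, by omega⟩ < w ⟨i, h2⟩) : len (w * sGen n i) = len w + 1 := by
  set s := sGen n i
  have hss : ∀ x, s (s x) = x := fun x => by
    rw [← Equiv.Perm.mul_apply, sGen_mul_self, Equiv.Perm.one_apply]
  have hord : ∀ x y : Fin n, x < y → ¬ ((x : ℕ) = i - 1 ∧ (y : ℕ) = i) → s x < s y := by
    intro x y hxy hne
    rw [Fin.lt_def] at hxy ⊢
    rw [sGen_apply_val h1 h2, sGen_apply_val h1 h2]
    split_ifs <;> omega
  have key : (Finset.univ.filter (fun p : Fin n × Fin n =>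
        p.1 < p.2 ∧ (w * s) p.2 < (w * s) p.1)) =
      insert ((⟨i - 1, by omega⟩, ⟨i, h2⟩) : Fin n × Fin n)
        ((Finset.univ.filter (fun p : Fin n × Fin n => p.1 < p.2 ∧ w p.2 < w p.1)).map
          (s.prodCongr s).toEmbedding) := by
    ext ⟨x, y⟩
    rw [Finset.mem_filter, Finset.mem_insert, Finset.mem_map]
    simp only [Finset.mem_filter, Finset.mem_univ, true_and, Equiv.Perm.mul_apply, Prod.exists,
      Equiv.coe_toEmbedding, Equiv.prodCongr_apply, Prod.map_apply, Prod.mk.injEq]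
    constructor
    · rintro ⟨hxy, hw⟩
      by_cases hne : (x : ℕ) = i - 1 ∧ (y : ℕ) = i
      · exact Or.inl ⟨Fin.ext hne.1, Fin.ext hne.2⟩
      · exact Or.inr ⟨s x, s y, ⟨hord x y hxy hne, hw⟩, hss x, hss y⟩
    · rintro (⟨rfl, rfl⟩ | ⟨a, b, ⟨hab, hw⟩, rfl, rfl⟩)
      · rw [sGen_apply_left h1 h2, sGen_apply_right h1 h2]
        exact ⟨by rw [Fin.lt_def]; simp only; omega, h⟩
      · rw [hss, hss]
        refine ⟨hord a b hab ?_, hw⟩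
        rintro ⟨ha, hb⟩
        have ha' : a = ⟨i - 1, by omega⟩ := Fin.ext ha
        have hb' : b = ⟨i, h2⟩ := Fin.ext hb
        rw [ha', hb'] at hw
        exact lt_asymm h hw
  rw [len, len, key, Finset.card_insert_of_notMem, Finset.card_map]
  simp only [Finset.mem_map, Finset.mem_filter, Finset.mem_univ, true_and, Prod.exists,
    Equiv.coe_toEmbedding, Equiv.prodCongr_apply, Prod.map_apply, Prod.mk.injEq]
  rintro ⟨a, b, ⟨hab, -⟩, ha, hb⟩
  have ha' : a = ⟨i, h2⟩ := by rw [← hss a, ha, sGen_apply_left h1 h2]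
  have hb' : b = ⟨i - 1, by omega⟩ := by rw [← hss b, hb, sGen_apply_right h1 h2]
  rw [ha', hb', Fin.lt_def] at hab
  simp only at hab
  omega

/-- The ascending product `s_a s_{a+1} ⋯ s_{a+m-1}` of adjacent transpositions. -/
def ascPerm (n a m : ℕ) : Equiv.Perm (Fin n) := ((List.range m).map (fun t => sGen n (a + t))).prod

lemma ascPerm_zero (a : ℕ) : ascPerm n a 0 = 1 := rfl

lemma ascPerm_succ (a m : ℕ) : ascPerm n a (m + 1) = ascPerm n a m * sGen n (a + m) := by
  simp [ascPerm, List.range_succ]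

lemma ascPerm_apply_val {a m : ℕ} (ha : 1 ≤ a) (h : a + m ≤ n) (x : Fin n) :
    (ascPerm n a m x : ℕ) = if a - 1 ≤ (x : ℕ) ∧ (x : ℕ) < a + m - 1 then (x : ℕ) + 1
      else if (x : ℕ) = a + m - 1 then a - 1 else x := by
  induction m generalizing x with
  | zero =>
    rw [ascPerm_zero, Equiv.Perm.one_apply]
    split_ifs <;> omega
  | succ m ih =>
    rw [ascPerm_succ, Equiv.Perm.mul_apply, ih (by omega), sGen_apply_val (by omega) (by omega)]
    split_ifs <;> omega

lemma ascPerm_inv_apply_val {a m : ℕ} (ha : 1 ≤ a) (h : a + m ≤ n) (x : Fin n) :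
    ((ascPerm n a m)⁻¹ x : ℕ) = if (x : ℕ) = a - 1 then a + m - 1
      else if a - 1 < (x : ℕ) ∧ (x : ℕ) ≤ a + m - 1 then (x : ℕ) - 1 else x := by
  induction m with
  | zero =>
    rw [ascPerm_zero, inv_one, Equiv.Perm.one_apply]
    split_ifs <;> omega
  | succ m ih =>
    rw [ascPerm_succ, mul_inv_rev, Equiv.Perm.mul_apply, sGen_inv,
      sGen_apply_val (by omega) (by omega), ih (by omega)]
    split_ifs <;> omega

/-- A permutation whose inverse is increasing beyond `k` is determined by the values of its
inverse on the first `k` points. -/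
lemma perm_eq_of_inv_strictMonoOn {k : ℕ} {d e : Equiv.Perm (Fin n)}
    (hd : ∀ a b : Fin n, k ≤ (a : ℕ) → a < b → d⁻¹ a < d⁻¹ b)
    (he : ∀ a b : Fin n, k ≤ (a : ℕ) → a < b → e⁻¹ a < e⁻¹ b)
    (hde : ∀ a : Fin n, (a : ℕ) < k → d⁻¹ a = e⁻¹ a) : d = e := by
  set u := e * d⁻¹ with hu
  have hfix : ∀ a : Fin n, (a : ℕ) < k → u a = a := fun a ha => by
    rw [hu, Equiv.Perm.mul_apply, hde a ha, ← Equiv.Perm.mul_apply, mul_inv_cancel,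
      Equiv.Perm.one_apply]
  have hge : ∀ a : Fin n, k ≤ (a : ℕ) → k ≤ (u a : ℕ) := fun a ha => by
    by_contra hlt
    have := u.injective (hfix _ (not_le.1 hlt))
    rw [this] at hlt
    exact hlt ha
  have hinv : ∀ a, e⁻¹ (u a) = d⁻¹ a := fun a => by simp [hu]
  have hmono : StrictMono u := by
    intro a b hab
    by_cases ha : k ≤ (a : ℕ)
    · have hb : k ≤ (b : ℕ) := ha.trans hab.le
      by_contra hle
      rcases (not_lt.1 hle).lt_or_eq with hlt | heq
      · have h1 := he _ _ (hge b hb) hlt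
        rw [hinv, hinv] at h1
        exact lt_asymm h1 (hd a b ha hab)
      · exact hab.ne' (u.injective heq)
    · rw [hfix a (not_le.1 ha)]
      by_cases hb : k ≤ (b : ℕ)
      · exact (not_le.1 ha).trans_le (hge b hb)
      · rwa [hfix b (not_le.1 hb)]
  have hrange : (u : Fin n → Fin n) = id :=
    (hmono.range_inj strictMono_id).1 (by simp [u.surjective.range_eq])
  have hu1 : u = 1 := Equiv.ext (fun x => congrFun hrange x)
  rw [hu] at hu1
  exact (mul_inv_eq_one.1 hu1).symm

lemma blockOf_pair (a b k : ℕ) :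
    blockOf [a, b] k = (if a ≤ k then 1 else 0) + (if a + b ≤ k then 1 else 0) := by
  simp only [blockOf, List.length_cons, List.length_nil, List.range_succ, List.range_zero]
  split_ifs <;> simp_all

lemma blockOf_mono {μ : List ℕ} {k l : ℕ} (h : k ≤ l) : blockOf μ k ≤ blockOf μ l := by
  refine (List.Sublist.length_le (List.monotone_filter_right _ ?_))
  intro j hj
  simp only [decide_eq_true_eq] at hj ⊢
  exact hj.trans h

/-- The minimal-length right coset representatives of a Young subgroup are the permutations whose
inverse increases on each block. -/
lemma mem_Dset {μ : List ℕ} {d : Equiv.Perm (Fin n)} :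
    d ∈ Dset n μ ↔ ∀ a b : Fin n, a < b → blockOf μ a = blockOf μ b → d⁻¹ a < d⁻¹ b := by
  classical
  simp only [Dset, youngSet, Finset.mem_filter, Finset.mem_univ, true_and]
  constructor
  · intro hd
    have hadj : ∀ i, 1 ≤ i → ∀ h2 : i < n, blockOf μ (i - 1) = blockOf μ i →
        d⁻¹ ⟨i - 1, by omega⟩ < d⁻¹ ⟨i, h2⟩ := by
      intro i h1 h2 hblock
      by_contra hle
      have hlt : d⁻¹ ⟨i, h2⟩ < d⁻¹ ⟨i - 1, by omega⟩ := by
        refine lt_of_le_of_ne (not_lt.1 hle) fun h => ?_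
        have := congrArg Fin.val (d⁻¹.injective h)
        simp only at this
        omega
      have hlen : len (d⁻¹ * sGen n i * sGen n i) = len (d⁻¹ * sGen n i) + 1 := by
        apply len_mul_sGen _ h1 h2
        rw [Equiv.Perm.mul_apply, Equiv.Perm.mul_apply, sGen_apply_left h1 h2,
          sGen_apply_right h1 h2]
        exact hlt
      rw [mul_assoc, sGen_mul_self, mul_one, len_inv, ← len_inv (d⁻¹ * _), mul_inv_rev, inv_inv,
        sGen_inv] at hlen
      have := hd (sGen n i) (fun a => by
        rw [sGen_apply_val h1 h2]
        split_ifs with ha hb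
        · rw [ha, hblock]
        · rw [hb, hblock]
        · rfl)
      omega
    have hstep : ∀ m : ℕ, ∀ a b : Fin n, (b : ℕ) = a + m + 1 → blockOf μ a = blockOf μ b →
        d⁻¹ a < d⁻¹ b := by
      intro m
      induction m with
      | zero =>
        intro a b hab hblock
        have := hadj b (by omega) b.isLt (by rw [← hblock]; congr 1; omega)
        rwa [show (⟨(b : ℕ) - 1, by omega⟩ : Fin n) = a from Fin.ext (by simp only; omega)] at this
      | succ m ih =>
        intro a b hab hblock
        have hl := blockOf_mono (μ := μ) (k := a) (l := b - 1) (by omega)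
        have hr := blockOf_mono (μ := μ) (k := b - 1) (l := b) (by omega)
        have h1 := ih a ⟨b - 1, by omega⟩ (by simp only; omega) (by simp only; omega)
        exact h1.trans (hadj b (by omega) b.isLt (by omega))
    intro a b hab
    exact hstep (b - a - 1) a b (by rw [Fin.lt_def] at hab; omega)
  · intro hd u hu
    refine Finset.card_le_card fun p hp => ?_
    rw [Finset.mem_filter] at hp ⊢
    replace hp := hp.2
    refine ⟨Finset.mem_univ p, hp.1, ?_⟩
    rw [Equiv.Perm.mul_apply, Equiv.Perm.mul_apply]
    by_contra hle
    have h1 := blockOf_mono (μ := μ) (Fin.le_def.1 (not_lt.1 hle))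
    rw [hu, hu] at h1
    have h2 := hd _ _ hp.2 (le_antisymm (blockOf_mono (Fin.le_def.1 hp.2.le)) h1)
    simp only [← Equiv.Perm.mul_apply, inv_mul_cancel, Equiv.Perm.one_apply] at h2
    exact lt_asymm hp.1 h2

lemma mem_Dset_one (hn : 1 ≤ n) {d : Equiv.Perm (Fin n)} :
    d ∈ Dset n [1, n - 1] ↔ ∀ a b : Fin n, 1 ≤ (a : ℕ) → a < b → d⁻¹ a < d⁻¹ b := by
  simp only [mem_Dset, blockOf_pair]
  refine forall_congr' fun a => forall_congr' fun b => ?_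
  have ha := a.isLt
  have hb := b.isLt
  rw [Fin.lt_def]
  constructor
  · intro h h1 h2
    exact h h2 (by split_ifs <;> omega)
  · intro h h1 h2
    exact h (by split_ifs at h2 <;> omega) h1

lemma mem_Dset_two (hn : 2 ≤ n) {d : Equiv.Perm (Fin n)} :
    d ∈ Dset n [2, n - 2] ↔ d⁻¹ ⟨0, by omega⟩ < d⁻¹ ⟨1, hn⟩ ∧
      ∀ a b : Fin n, 2 ≤ (a : ℕ) → a < b → d⁻¹ a < d⁻¹ b := by
  simp only [mem_Dset, blockOf_pair]
  constructor
  · intro h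
    refine ⟨h _ _ (by rw [Fin.lt_def]; simp) (by simp only; split_ifs <;> omega),
      fun a b ha hab => h _ _ hab ?_⟩
    rw [Fin.lt_def] at hab
    split_ifs <;> omega
  · rintro ⟨h01, h⟩ a b hab hblock
    by_cases ha : 2 ≤ (a : ℕ)
    · exact h a b ha hab
    · rw [Fin.lt_def] at hab
      have hb : (b : ℕ) < 2 := by
        split_ifs at hblock <;> omega
      rwa [show a = ⟨0, by omega⟩ from Fin.ext (by simp only; omega),
        show b = ⟨1, hn⟩ from Fin.ext (by simp only; omega)]

lemma sum_Dset_one {M : Type*} [AddCommMonoid M] (hn : 1 ≤ n) (f : Equiv.Perm (Fin n) → M) :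
    ∑ d ∈ Dset n [1, n - 1], f d = ∑ m ∈ Finset.range n, f (ascPerm n 1 m) := by
  have hmem : ∀ m, m < n → ascPerm n 1 m ∈ Dset n [1, n - 1] := by
    intro m hm
    rw [mem_Dset_one hn]
    intro a b ha hab
    rw [Fin.lt_def] at hab ⊢
    rw [ascPerm_inv_apply_val le_rfl (by omega), ascPerm_inv_apply_val le_rfl (by omega)]
    split_ifs <;> omega
  have hzero : ∀ m, m < n → ((ascPerm n 1 m)⁻¹ ⟨0, hn⟩ : ℕ) = m := by
    intro m hm
    rw [ascPerm_inv_apply_val le_rfl (by omega)]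
    simp
  symm
  refine Finset.sum_bij (fun m _ => ascPerm n 1 m) (fun m hm => hmem m (Finset.mem_range.1 hm))
    (fun m hm m' hm' h => ?_) (fun d hd => ?_) (fun _ _ => rfl)
  · rw [← hzero m (Finset.mem_range.1 hm), ← hzero m' (Finset.mem_range.1 hm'), h]
  · refine ⟨d⁻¹ ⟨0, hn⟩, Finset.mem_range.2 (Fin.isLt _), ?_⟩
    refine perm_eq_of_inv_strictMonoOn (k := 1) ((mem_Dset_one hn).1 (hmem _ (Fin.isLt _)))
      ((mem_Dset_one hn).1 hd) fun a ha => ?_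
    obtain rfl : a = ⟨0, hn⟩ := Fin.ext (by simp only; omega)
    exact Fin.ext (hzero _ (Fin.isLt _))

lemma sum_Dset_two {M : Type*} [AddCommMonoid M] (hn : 2 ≤ n) (f : Equiv.Perm (Fin n) → M) :
    ∑ d ∈ Dset n [2, n - 2], f d = ∑ p ∈ Finset.range (n - 1), ∑ j ∈ Finset.range (p + 1),
      f (ascPerm n 2 p * ascPerm n 1 j) := by
  have hzero : ∀ p j, p + 2 ≤ n → j ≤ p →
      ((ascPerm n 2 p * ascPerm n 1 j)⁻¹ ⟨0, by omega⟩ : ℕ) = j := by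
    intro p j hp hj
    rw [mul_inv_rev, Equiv.Perm.mul_apply, ascPerm_inv_apply_val le_rfl (by omega),
      ascPerm_inv_apply_val (by omega) (by omega)]
    simp
  have hone : ∀ p j, p + 2 ≤ n → j ≤ p →
      ((ascPerm n 2 p * ascPerm n 1 j)⁻¹ ⟨1, hn⟩ : ℕ) = p + 1 := by
    intro p j hp hj
    rw [mul_inv_rev, Equiv.Perm.mul_apply, ascPerm_inv_apply_val le_rfl (by omega),
      ascPerm_inv_apply_val (by omega) (by omega)]
    split_ifs <;> simp_all <;> omega
  have hmem : ∀ p j, p + 2 ≤ n → j ≤ p →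
      ascPerm n 2 p * ascPerm n 1 j ∈ Dset n [2, n - 2] := by
    intro p j hp hj
    rw [mem_Dset_two hn]
    refine ⟨by rw [Fin.lt_def, hzero p j hp hj, hone p j hp hj]; omega, ?_⟩
    intro a b ha hab
    rw [Fin.lt_def] at hab ⊢
    rw [mul_inv_rev, Equiv.Perm.mul_apply, Equiv.Perm.mul_apply,
      ascPerm_inv_apply_val le_rfl (by omega), ascPerm_inv_apply_val le_rfl (by omega),
      ascPerm_inv_apply_val (by omega) (by omega), ascPerm_inv_apply_val (by omega) (by omega)]
    split_ifs <;> omega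
  rw [Finset.sum_sigma']
  symm
  refine Finset.sum_bij (fun x _ => ascPerm n 2 x.1 * ascPerm n 1 x.2) (fun x hx => ?_)
    (fun x hx y hy h => ?_) (fun d hd => ?_) (fun _ _ => rfl)
  · simp only [Finset.mem_sigma, Finset.mem_range] at hx
    exact hmem _ _ (by omega) (by omega)
  · simp only [Finset.mem_sigma, Finset.mem_range] at hx hy
    obtain ⟨p, j⟩ := x
    obtain ⟨p', j'⟩ := y
    simp only at hx hy h
    have h0 := hzero p j (by omega) (by omega)
    have h1 := hone p j (by omega) (by omega)
    rw [h, hzero p' j' (by omega) (by omega)] at h0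
    rw [h, hone p' j' (by omega) (by omega)] at h1
    obtain rfl : p = p' := by omega
    rw [h0]
  · have hd' := (mem_Dset_two hn).1 hd
    have hlt := Fin.lt_def.1 hd'.1
    have hy := (d⁻¹ ⟨1, hn⟩).isLt
    have hp : ((d⁻¹ ⟨1, hn⟩ : Fin n) : ℕ) - 1 + 2 ≤ n := by omega
    have hj : ((d⁻¹ ⟨0, by omega⟩ : Fin n) : ℕ) ≤ (d⁻¹ ⟨1, hn⟩ : Fin n) - 1 := by omega
    refine ⟨⟨(d⁻¹ ⟨1, hn⟩ : Fin n) - 1, (d⁻¹ ⟨0, by omega⟩ : Fin n)⟩, ?_, ?_⟩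
    · simp only [Finset.mem_sigma, Finset.mem_range]
      omega
    · refine perm_eq_of_inv_strictMonoOn (k := 2) ((mem_Dset_two hn).1 (hmem _ _ hp hj)).2 hd'.2
        fun a ha => ?_
      obtain h | h : (a : ℕ) = 0 ∨ (a : ℕ) = 1 := by omega
      · rw [show a = ⟨0, by omega⟩ from Fin.ext h]
        exact Fin.ext (hzero _ _ hp hj)
      · rw [show a = ⟨1, hn⟩ from Fin.ext h]
        exact Fin.ext ((hone _ _ hp hj).trans (by omega))

end Permutations

section BMW

variable {F : Type*} [Field F] {A : Type*} [Ring A] [Algebra F A] {n : ℕ} {q r : F}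

/-- The ascending product `T_a T_{a+1} ⋯ T_{a+m-1}`. -/
def ascProd (T : ℕ → A) (a m : ℕ) : A := ((List.range m).map (fun t => T (a + t))).prod

lemma ascProd_zero (T : ℕ → A) (a : ℕ) : ascProd T a 0 = 1 := rfl

lemma ascProd_succ (T : ℕ → A) (a m : ℕ) : ascProd T a (m + 1) = ascProd T a m * T (a + m) := by
  simp [ascProd, List.range_succ]

lemma ascProd_succ' (T : ℕ → A) (a m : ℕ) :
    ascProd T a (m + 1) = T a * ascProd T (a + 1) m := by
  simp only [ascProd, List.range_succ_eq_map, List.map_cons, List.map_map, List.prod_cons, add_zero]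
  congr 2
  refine List.map_congr_left fun t _ => ?_
  rw [Function.comp_apply, Nat.succ_eq_add_one, add_assoc, add_comm 1 t]

namespace BMWData

variable (D : BMWData F A n q r)

lemma len_Tw_mul_ascPerm {a m : ℕ} (ha : 1 ≤ a) (h : a + m ≤ n) (u : Equiv.Perm (Fin n))
    (hu : ∀ x y : Fin n, (x : ℕ) = a - 1 → x < y → u x < u y) :
    len (u * ascPerm n a m) = len u + m ∧
      D.Tw (u * ascPerm n a m) = D.Tw u * ascProd D.T a m := by
  induction m with
  | zero => simp [ascPerm_zero, ascProd_zero]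
  | succ m ih =>
    obtain ⟨ih1, ih2⟩ := ih (by omega)
    have hs : len (sGen n (a + m)) = 1 := by
      have := len_mul_sGen (1 : Equiv.Perm (Fin n)) (i := a + m) (by omega) (by omega)
        (by simp only [Equiv.Perm.one_apply, Fin.lt_def]; omega)
      rwa [one_mul, len_one] at this
    have hl : len (u * ascPerm n a m * sGen n (a + m)) = len (u * ascPerm n a m) + 1 := by
      apply len_mul_sGen _ (by omega) (by omega)
      rw [Equiv.Perm.mul_apply, Equiv.Perm.mul_apply]
      apply hu
      · rw [ascPerm_apply_val ha (by omega)]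
        simp only
        split_ifs <;> omega
      · rw [Fin.lt_def, ascPerm_apply_val ha (by omega), ascPerm_apply_val ha (by omega)]
        simp only
        split_ifs <;> omega
    rw [ascPerm_succ, ← mul_assoc, ascProd_succ, ← mul_assoc, ← ih2]
    refine ⟨by omega, ?_⟩
    rw [D.Tw_mul _ _ (by omega), D.Tw_s _ (by omega) (by omega)]

lemma hat_Dset_one (hn : 1 ≤ n) :
    hat q D.Tw (Dset n [1, n - 1]) = ∑ m ∈ Finset.range n, q ^ m • ascProd D.T 1 m := by
  rw [hat, sum_Dset_one hn]
  refine Finset.sum_congr rfl fun m hm => ?_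
  rw [Finset.mem_range] at hm
  have h := D.len_Tw_mul_ascPerm (m := m) le_rfl (by omega) 1 (fun _ _ _ hxy => hxy)
  rw [one_mul, len_one, zero_add, D.Tw_one, one_mul] at h
  rw [h.1, h.2]

lemma hat_Dset_two (hn : 2 ≤ n) :
    hat q D.Tw (Dset n [2, n - 2]) = ∑ p ∈ Finset.range (n - 1), ∑ j ∈ Finset.range (p + 1),
      q ^ (p + j) • (ascProd D.T 2 p * ascProd D.T 1 j) := by
  rw [hat, sum_Dset_two hn]
  refine Finset.sum_congr rfl fun p hp => Finset.sum_congr rfl fun j hj => ?_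
  rw [Finset.mem_range] at hp hj
  have h := D.len_Tw_mul_ascPerm (a := 2) (m := p) (by omega) (by omega) 1 (fun _ _ _ hxy => hxy)
  rw [one_mul, len_one, zero_add, D.Tw_one, one_mul] at h
  have h' := D.len_Tw_mul_ascPerm (m := j) le_rfl (by omega) (ascPerm n 2 p) (by
    intro x y hx hxy
    rw [Fin.lt_def] at hxy ⊢
    rw [ascPerm_apply_val (by omega) (by omega), ascPerm_apply_val (by omega) (by omega)]
    split_ifs <;> omega)
  rw [h'.1, h'.2, h.1, h.2]

lemma hat_filter_mul_sGen {i : ℕ} (h1 : 1 ≤ i) (h2 : i < n) (P Q : Equiv.Perm (Fin n) → Prop)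
    [DecidablePred P] [DecidablePred Q]
    (hP : ∀ w, P w → w ⟨i - 1, by omega⟩ < w ⟨i, h2⟩) (hPQ : ∀ w, Q (w * sGen n i) ↔ P w) :
    hat q D.Tw (Finset.univ.filter Q) = q • (hat q D.Tw (Finset.univ.filter P) * D.T i) := by
  have hs : len (sGen n i) = 1 := by
    have := len_mul_sGen (1 : Equiv.Perm (Fin n)) h1 h2
      (by simp only [Equiv.Perm.one_apply, Fin.lt_def]; omega)
    rwa [one_mul, len_one] at this
  rw [hat, hat, Finset.sum_mul, Finset.smul_sum]
  symm
  refine Finset.sum_equiv (Equiv.mulRight (sGen n i)) (fun w => ?_) (fun w hw => ?_)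
  · simp [hPQ]
  · rw [Finset.mem_filter] at hw
    have hl := len_mul_sGen w h1 h2 (hP w hw.2)
    rw [Equiv.coe_mulRight, D.Tw_mul w _ (by omega), D.Tw_s i h1 (by omega), hl, pow_succ',
      mul_smul, smul_mul_assoc]

/-- `Ŝ_n` is a left multiple of the sum over the parabolic subgroup generated by `s_i`. -/
lemma hat_univ_eq_mul {i : ℕ} (h1 : 1 ≤ i) (h2 : i < n) :
    hat q D.Tw (Finset.univ : Finset (Equiv.Perm (Fin n))) =
      hat q D.Tw (Finset.univ.filter (fun w : Equiv.Perm (Fin n) =>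
        w ⟨i - 1, by omega⟩ < w ⟨i, h2⟩)) * (1 + q • D.T i) := by
  have h := D.hat_filter_mul_sGen h1 h2
    (fun w => w ⟨i - 1, by omega⟩ < w ⟨i, h2⟩) (fun w => ¬ w ⟨i - 1, by omega⟩ < w ⟨i, h2⟩)
    (fun _ h => h) (fun w => by
      rw [Equiv.Perm.mul_apply, Equiv.Perm.mul_apply, sGen_apply_left h1 h2,
        sGen_apply_right h1 h2, not_lt, le_iff_lt_or_eq, or_iff_left]
      intro h
      have := congrArg Fin.val (w.injective h)
      simp only at this
      omega)
  rw [mul_add, mul_one, mul_smul_comm, ← h]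
  exact (Finset.sum_filter_add_sum_filter_not _ _ _).symm

/-- `Ŝ_n` is a left multiple of the sum over the parabolic subgroup generated by `s_i` and
`s_{i+1}`. -/
lemma exists_hat_univ_eq_mul_s4 {i : ℕ} (h1 : 1 ≤ i) (h2 : i + 1 < n) :
    ∃ Y : A, hat q D.Tw (Finset.univ : Finset (Equiv.Perm (Fin n))) =
      Y * (1 + q • D.T (i + 1) + q ^ 2 • (D.T i * D.T (i + 1))) * (1 + q • D.T i) := by
  set a : Fin n := ⟨i - 1, by omega⟩ with ha
  set b : Fin n := ⟨i, by omega⟩ with hb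
  set c : Fin n := ⟨i + 1, h2⟩ with hc
  have hac : a ≠ c := by rw [ha, hc, Ne, Fin.mk.injEq]; omega
  have hbc : b ≠ c := by rw [hb, hc, Ne, Fin.mk.injEq]; omega
  have sa : sGen n i a = b := sGen_apply_left h1 (by omega)
  have sb : sGen n i b = a := sGen_apply_right h1 (by omega)
  have sc : sGen n i c = c := sGen_apply_of_ne h1 (by omega) (by simp only [hc]; omega)
    (by simp only [hc]; omega)
  have ta : sGen n (i + 1) a = a :=
    sGen_apply_of_ne (by omega) h2 (by simp only [ha]; omega) (by simp only [ha]; omega)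
  have tb : sGen n (i + 1) b = c := sGen_apply_left (by omega) h2
  have tc : sGen n (i + 1) c = b := sGen_apply_right (by omega) h2
  let H (P : Equiv.Perm (Fin n) → Prop) [DecidablePred P] : A :=
    hat q D.Tw (Finset.univ.filter P)
  have e1 : H (fun w => w a < w c ∧ w c < w b) =
      q • (H (fun w => w a < w b ∧ w b < w c) * D.T (i + 1)) :=
    D.hat_filter_mul_sGen (by omega) h2 _ _ (fun _ h => h.2) (fun w => by
      simp only [Equiv.Perm.mul_apply, ta, tb, tc])
  have e2 : H (fun w => w b < w a ∧ w a < w c) =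
      q • (H (fun w => w a < w b ∧ w b < w c) * D.T i) :=
    D.hat_filter_mul_sGen h1 (by omega) _ _ (fun _ h => h.1) (fun w => by
      simp only [Equiv.Perm.mul_apply, sa, sb, sc])
  have e3 : H (fun w => w c < w a ∧ w a < w b) =
      q • (H (fun w => w b < w a ∧ w a < w c) * D.T (i + 1)) :=
    D.hat_filter_mul_sGen (by omega) h2 _ _ (fun _ h => h.1.trans h.2) (fun w => by
      simp only [Equiv.Perm.mul_apply, ta, tb, tc])
  have e4 : H (fun w => w a < w b) = H (fun w => w a < w b ∧ w b < w c) +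
      H (fun w => w a < w c ∧ w c < w b) + H (fun w => w c < w a ∧ w a < w b) := by
    simp only [H, hat, Finset.sum_filter, ← Finset.sum_add_distrib]
    refine Finset.sum_congr rfl fun w _ => ?_
    have nac : w a ≠ w c := fun h => hac (w.injective h)
    have nbc : w b ≠ w c := fun h => hbc (w.injective h)
    rcases lt_or_gt_of_ne nac with h | h <;> rcases lt_or_gt_of_ne nbc with h' | h'
    · simp [h, h', h'.not_gt, h.not_gt]
    · simp [h, h', h'.not_gt, h.not_gt, h.trans h']
    · simp [h, h', h'.not_gt, h.not_gt, (h'.trans h).not_gt]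
    · simp [h, h', h'.not_gt, h.not_gt]
  refine ⟨H (fun w => w a < w b ∧ w b < w c), ?_⟩
  rw [D.hat_univ_eq_mul h1 (by omega)]
  change H (fun w => w a < w b) * _ = _
  rw [e4, e3, e2, e1]
  simp only [mul_add, mul_one, smul_mul_assoc, mul_smul_comm, smul_smul, mul_assoc, pow_two]

lemma T_sq {i : ℕ} (h1 : 1 ≤ i) (h2 : i ≤ n - 1) :
    D.T i * D.T i = 1 + (q - q⁻¹) • D.T i - ((q - q⁻¹) * r⁻¹) • D.E i := by
  have h := congrArg (D.T i * ·) (D.skein i h1 h2)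
  simp only [mul_sub, mul_smul_comm, mul_one, D.T_mul_Tinv i h1 h2, D.TE i h1 h2, smul_sub,
    smul_smul] at h
  rw [sub_eq_iff_eq_add] at h
  rw [h]
  abel

lemma hat_univ_mul_T (hrq : r + q ≠ 0) {i : ℕ} (h1 : 1 ≤ i) (h2 : i ≤ n - 1) :
    hat q D.Tw (Finset.univ : Finset (Equiv.Perm (Fin n))) * D.T i =
      q • hat q D.Tw (Finset.univ : Finset (Equiv.Perm (Fin n))) +
      ((1 - q ^ 2) / (r + q)) •
        (hat q D.Tw (Finset.univ : Finset (Equiv.Perm (Fin n))) * D.E i) := by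
  have hq := D.hq
  have hr := D.hr
  have key : (1 + q • D.T i) * D.T i = q • (1 + q • D.T i) +
      ((1 - q ^ 2) / (r + q)) • ((1 + q • D.T i) * D.E i) := by
    simp only [add_mul, one_mul, smul_mul_assoc, D.T_sq h1 h2, D.TE i h1 h2]
    match_scalars <;> field_simp <;> ring
  rw [D.hat_univ_eq_mul h1 (by omega), mul_assoc, key, mul_add, mul_smul_comm, mul_smul_comm,
    mul_assoc]

lemma E_eq {i : ℕ} (h1 : 1 ≤ i) (h2 : i ≤ n - 1) :
    D.E i = 1 - (q - q⁻¹)⁻¹ • (D.T i - D.Tinv i) := by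
  rw [D.skein i h1 h2, smul_smul, inv_mul_cancel₀ D.hqq, one_smul, sub_sub_cancel]

lemma E_mul_T_succ_mul_T {i : ℕ} (h1 : 1 ≤ i) (h2 : i + 1 ≤ n - 1) :
    D.E i * D.T (i + 1) * D.T i = D.E i * D.E (i + 1) := by
  have hinv : D.Tinv i * (D.T (i + 1) * D.T i) = D.T (i + 1) * D.T i * D.Tinv (i + 1) := by
    calc D.Tinv i * (D.T (i + 1) * D.T i)
        = D.Tinv i * (D.T (i + 1) * D.T i * D.T (i + 1)) * D.Tinv (i + 1) := by
          simp only [mul_assoc, D.T_mul_Tinv (i + 1) (by omega) h2, mul_one]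
      _ = (D.Tinv i * D.T i) * (D.T (i + 1) * D.T i) * D.Tinv (i + 1) := by
          rw [← D.braid i h1 h2]
          simp only [mul_assoc]
      _ = D.T (i + 1) * D.T i * D.Tinv (i + 1) := by
          rw [D.Tinv_mul_T i h1 (by omega), one_mul]
  have hT : D.T i * (D.T (i + 1) * D.T i) = D.T (i + 1) * D.T i * D.T (i + 1) := by
    rw [← mul_assoc, D.braid i h1 h2]
  rw [← D.TTE₂ i h1 h2, D.E_eq h1 (by omega), D.E_eq (i := i + 1) (by omega) h2, mul_assoc]
  simp only [sub_mul, mul_sub, smul_mul_assoc, mul_smul_comm, one_mul, mul_one, hinv, hT]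

lemma hat_univ_mul_E_mul_E_succ {i : ℕ} (h1 : 1 ≤ i) (h2 : i + 1 ≤ n - 1) :
    hat q D.Tw (Finset.univ : Finset (Equiv.Perm (Fin n))) * D.E i * D.E (i + 1) =
      hat q D.Tw (Finset.univ : Finset (Equiv.Perm (Fin n))) * D.E (i + 1) := by
  have hq := D.hq
  have hr := D.hr
  obtain ⟨Y, hY⟩ := D.exists_hat_univ_eq_mul_s4 h1 (by omega)
  set e := D.E (i + 1) with he
  set f := D.E i * D.E (i + 1) with hf
  set g := D.T i * e with hg
  have te : D.T (i + 1) * e = r⁻¹ • e := D.TE (i + 1) (by omega) h2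
  have sf : D.T i * f = r⁻¹ • f := by
    rw [hf, ← mul_assoc, D.TE i h1 (by omega), smul_mul_assoc]
  have tg : D.T (i + 1) * g = f := by rw [hg, ← mul_assoc, D.TTE₂ i h1 h2]
  have stf : D.T i * (D.T (i + 1) * f) = e := by
    rw [hf, ← mul_assoc, ← mul_assoc, D.TTE₁ i h1 h2, D.EEE₂ i h1 h2]
  have sg : D.T i * g = e + (q - q⁻¹) • g - ((q - q⁻¹) * r⁻¹) • f := by
    rw [hg, ← mul_assoc, D.T_sq h1 (by omega), sub_mul, add_mul, one_mul, smul_mul_assoc,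
      smul_mul_assoc]
  have tf : D.T (i + 1) * f = g - (q - q⁻¹) • e + (q - q⁻¹) • f := by
    have h := congrArg (D.Tinv i * ·) stf
    simp only [← mul_assoc, D.Tinv_mul_T i h1 (by omega), one_mul] at h
    have hs : D.Tinv i = D.T i - (q - q⁻¹) • (1 - D.E i) := by
      rw [← D.skein i h1 (by omega), sub_sub_cancel]
    rw [hs, sub_mul, smul_mul_assoc, sub_mul, one_mul, smul_sub] at h
    rw [h]
    abel
  have key : (1 + q • D.T (i + 1) + q ^ 2 • (D.T i * D.T (i + 1))) * ((1 + q • D.T i) * f) =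
      (1 + q • D.T (i + 1) + q ^ 2 • (D.T i * D.T (i + 1))) * ((1 + q • D.T i) * e) := by
    simp only [add_mul, mul_add, one_mul, smul_mul_assoc, mul_smul_comm, sf, ← hg, mul_assoc, te,
      tg, tf, sg, mul_sub, smul_sub, smul_add, smul_smul]
    match_scalars <;> field_simp <;> ring
  rw [hY, mul_assoc, mul_assoc, mul_assoc, mul_assoc, key]
  simp only [mul_assoc]

lemma commute_ascProd {i a m : ℕ} (hi : 1 ≤ i) (hia : i + 1 < a) (h : a + m ≤ n) :
    Commute (D.T i) (ascProd D.T a m) := by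
  refine Commute.list_prod_right _ _ fun x hx => ?_
  obtain ⟨t, ht, rfl⟩ := List.mem_map.1 hx
  rw [List.mem_range] at ht
  exact D.T_comm _ _ hi (by omega) (by omega) (by omega) (by omega)

lemma hat_univ_mul_E_one_mul_ascProd {p j : ℕ} (hp : p + 2 ≤ n) (hj : j ≤ p) :
    hat q D.Tw (Finset.univ : Finset (Equiv.Perm (Fin n))) * D.E 1 *
        (ascProd D.T 2 p * ascProd D.T 1 j) =
      hat q D.Tw (Finset.univ : Finset (Equiv.Perm (Fin n))) * D.E (j + 1) *
        ascProd D.T (j + 2) (p - j) := by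
  set S := hat q D.Tw (Finset.univ : Finset (Equiv.Perm (Fin n))) with hS
  induction j with
  | zero => simp [ascProd_zero]
  | succ j ih =>
    obtain ⟨k, rfl⟩ : ∃ k, p = j + 1 + k := ⟨p - (j + 1), by omega⟩
    have hcomm := (D.commute_ascProd (i := j + 1) (a := j + 3) (m := k) (by omega) (by omega)
      (by omega)).eq
    rw [ascProd_succ, ← mul_assoc (ascProd D.T 2 _), ← mul_assoc (S * D.E 1), ih (by omega),
      show j + 1 + k - j = k + 1 by omega, ascProd_succ', add_comm 1 j,
      show j + 1 + k - (j + 1) = k by omega]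
    calc S * D.E (j + 1) * (D.T (j + 2) * ascProd D.T (j + 2 + 1) k) * D.T (j + 1)
        = S * (D.E (j + 1) * D.T (j + 2) * D.T (j + 1)) * ascProd D.T (j + 3) k := by
          simp only [mul_assoc, hcomm]
      _ = S * D.E (j + 1) * D.E (j + 1 + 1) * ascProd D.T (j + 3) k := by
          rw [D.E_mul_T_succ_mul_T (i := j + 1) (by omega) (by omega)]
          simp only [mul_assoc]
      _ = S * D.E (j + 1 + 1) * ascProd D.T (j + 1 + 2) k := by
          rw [D.hat_univ_mul_E_mul_E_succ (by omega) (by omega)]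

lemma hat_univ_mul_ascProd (hrq : r + q ≠ 0) {m : ℕ} (hm : m + 1 ≤ n) :
    hat q D.Tw (Finset.univ : Finset (Equiv.Perm (Fin n))) * ascProd D.T 1 m =
      q ^ m • hat q D.Tw (Finset.univ : Finset (Equiv.Perm (Fin n))) +
      ∑ k ∈ Finset.range m, (((1 - q ^ 2) / (r + q)) * q ^ k) •
        (hat q D.Tw (Finset.univ : Finset (Equiv.Perm (Fin n))) * D.E (k + 1) *
          ascProd D.T (k + 2) (m - 1 - k)) := by
  set S := hat q D.Tw (Finset.univ : Finset (Equiv.Perm (Fin n))) with hS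
  induction m with
  | zero => simp [ascProd_zero]
  | succ m ih =>
    rw [ascProd_succ, ← mul_assoc, ih (by omega), add_mul, smul_mul_assoc,
      D.hat_univ_mul_T hrq (by omega) (by omega), ← hS, Finset.sum_mul, Finset.sum_range_succ,
      add_tsub_cancel_right, tsub_self, ascProd_zero, mul_one, smul_add, smul_smul, smul_smul,
      ← pow_succ, add_comm 1 m, mul_comm (q ^ m) (_ / _), add_assoc]
    congr 1
    rw [add_comm]
    congr 1
    refine Finset.sum_congr rfl fun k hk => ?_
    rw [Finset.mem_range] at hk
    obtain ⟨l, rfl⟩ : ∃ l, m = k + 1 + l := ⟨m - (k + 1), by omega⟩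
    rw [show k + 1 + l - 1 - k = l by omega, show k + 1 + l - k = l + 1 by omega, ascProd_succ,
      smul_mul_assoc, ← mul_assoc, show k + 2 + l = k + 1 + l + 1 by omega]

end BMWData

end BMW

/-- For `n ≥ 2` and `r + q ≠ 0`,
`Ŝ_n · D̂_{(1,n-1)} = (Σ_{i=0}^{n-1} q^{2i}) Ŝ_n + ((1-q²)/(q⁻¹r+1)) · Ŝ_n · E_1 · D̂_{(2,n-2)}`. -/
theorem statement4 {F : Type*} [Field F] {A : Type*} [Ring A] [Algebra F A]
    {n : ℕ} (hn : 2 ≤ n) {q r : F} (D : BMWData F A n q r) (hrq : r + q ≠ 0) :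
    hat q D.Tw (Finset.univ : Finset (Equiv.Perm (Fin n))) * hat q D.Tw (Dset n [1, n - 1]) =
      (∑ i ∈ Finset.range n, q ^ (2 * i)) •
        hat q D.Tw (Finset.univ : Finset (Equiv.Perm (Fin n))) +
      ((1 - q ^ 2) / (q⁻¹ * r + 1)) •
        (hat q D.Tw (Finset.univ : Finset (Equiv.Perm (Fin n))) * D.E 1 *
          hat q D.Tw (Dset n [2, n - 2])) := by
  have hq := D.hq
  rw [D.hat_Dset_one (by omega), D.hat_Dset_two hn]
  obtain ⟨N, rfl⟩ : ∃ N, n = N + 1 := ⟨n - 1, by omega⟩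
  have hsum : ∀ m ∈ Finset.range (N + 1),
      hat q D.Tw Finset.univ * (q ^ m • ascProd D.T 1 m) =
        q ^ (2 * m) • hat q D.Tw Finset.univ + ∑ k ∈ Finset.range m,
          (((1 - q ^ 2) / (r + q)) * q ^ (m + k)) •
            (hat q D.Tw Finset.univ * D.E (k + 1) * ascProd D.T (k + 2) (m - 1 - k)) := by
    intro m hm
    rw [Finset.mem_range] at hm
    rw [mul_smul_comm, D.hat_univ_mul_ascProd hrq (by omega), smul_add, smul_smul, ← pow_add,
      ← two_mul, Finset.smul_sum]
    congr 1
    refine Finset.sum_congr rfl fun k _ => ?_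
    rw [smul_smul, pow_add, mul_left_comm]
  rw [Finset.mul_sum, Finset.sum_congr rfl hsum, Finset.sum_add_distrib, ← Finset.sum_smul]
  congr 1
  rw [Finset.sum_range_succ', Finset.sum_range_zero, add_zero, Finset.mul_sum, Finset.smul_sum,
    add_tsub_cancel_right]
  refine Finset.sum_congr rfl fun p hp => ?_
  rw [Finset.mem_range] at hp
  rw [Finset.mul_sum, Finset.smul_sum]
  refine Finset.sum_congr rfl fun j hj => ?_
  rw [Finset.mem_range] at hj
  rw [mul_smul_comm, D.hat_univ_mul_E_one_mul_ascProd (by omega) (by omega), smul_smul,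
    add_tsub_cancel_right]
  congr 1
  have hrq' : q⁻¹ * r + 1 ≠ 0 := fun h => hrq (by
    have := congrArg (q * ·) h
    field_simp at this
    simpa using this)
  field_simp
  ring

end BMWPaper
end

section
/- For 0 ≤ 2f ≤ n, the cardinality of H_f(n) is n!/(2^f · f! · (n−2f)!). -/
open Finset
open scoped Pointwise

namespace BMWPaper

/-- An injective tuple in a linear order is sorted increasingly by exactly one permutation. -/
theorem existsUnique_perm_strictMono {k : ℕ} {α : Type*} [LinearOrder α] (g : Fin k → α)
    (hg : Function.Injective g) : ∃! σ : Equiv.Perm (Fin k), StrictMono (g ∘ σ) := by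
  refine ⟨Tuple.sort g,
    (Tuple.monotone_sort g).strictMono_of_injective (hg.comp (Tuple.sort g).injective), ?_⟩
  intro σ hσ
  have h := Tuple.unique_monotone hσ.monotone (Tuple.monotone_sort g)
  exact Equiv.ext fun i => hg (congrFun h i)

/-- If each point of `X` is moved into `Q` by exactly one member of a family of permutations
indexed by `K`, then `|X| = |Q| * |K|`. -/
theorem card_eq_card_filter_mul_of_existsUnique {X K : Type*} [Fintype X] [Fintype K]
    (Q : X → Prop) [DecidablePred Q] (φ : K → Equiv.Perm X) (hφ : ∀ x, ∃! k, Q (φ k x)) :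
    Fintype.card X = (univ.filter Q).card * Fintype.card K := by
  classical
  calc Fintype.card X = ∑ x : X, (univ.filter fun k => Q (φ k x)).card := by
        rw [Fintype.card_eq_sum_ones]
        refine Finset.sum_congr rfl fun x _ => ?_
        obtain ⟨k, hk, hu⟩ := hφ x
        refine (Finset.card_eq_one.2 ⟨k, ?_⟩).symm
        ext j
        simp only [mem_filter, mem_univ, true_and, mem_singleton]
        exact ⟨hu j, fun h => h ▸ hk⟩
    _ = ∑ k : K, (univ.filter fun x => Q (φ k x)).card := by
        simp only [Finset.card_filter]
        exact Finset.sum_comm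
    _ = ∑ _k : K, (univ.filter Q).card := by
        refine Finset.sum_congr rfl fun k _ => ?_
        refine Finset.card_equiv (φ k) fun x => ?_
        simp
    _ = (univ.filter Q).card * Fintype.card K := by
        simp [mul_comm]

/-- `f` ordered pairs and a sequence of `m` further points, arranged so that each pair, the
sequence of first members, and the final sequence are increasing. -/
def IsSortedArrangement {f m : ℕ} {α : Type*} [Preorder α]
    (e : (Fin f × Fin 2) ⊕ Fin m → α) : Prop :=
  StrictMono (fun i => e (Sum.inl (i, 0))) ∧ (∀ i, StrictMono fun b => e (Sum.inl (i, b))) ∧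
    StrictMono fun j => e (Sum.inr j)

/-- Permute the `f` pairs by `σ`, the members of the pair `i` by `τ i`, and the remaining
`m` points by `ρ`. -/
def rearrange {f m : ℕ} (σ : Equiv.Perm (Fin f)) (τ : Fin f → Equiv.Perm (Fin 2))
    (ρ : Equiv.Perm (Fin m)) : Equiv.Perm ((Fin f × Fin 2) ⊕ Fin m) :=
  Equiv.sumCongr (Equiv.prodShear σ fun i => τ (σ i)) ρ

theorem existsUnique_isSortedArrangement_rearrange {f m : ℕ} {α : Type*} [LinearOrder α]
    (e : (Fin f × Fin 2) ⊕ Fin m → α) (he : Function.Injective e) :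
    ∃! k : Equiv.Perm (Fin f) × (Fin f → Equiv.Perm (Fin 2)) × Equiv.Perm (Fin m),
      IsSortedArrangement (e ∘ rearrange k.1 k.2.1 k.2.2) := by
  choose τ hτ hτu using fun i : Fin f =>
    existsUnique_perm_strictMono (fun b => e (Sum.inl (i, b))) fun a b h => by
      simpa using he h
  obtain ⟨ρ, hρ, hρu⟩ := existsUnique_perm_strictMono (fun j => e (Sum.inr j)) fun a b h => by
    simpa using he h
  obtain ⟨σ, hσ, hσu⟩ := existsUnique_perm_strictMono (fun i => e (Sum.inl (i, τ i 0)))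
    fun a b h => by
      have h' := he h
      simp only [Sum.inl.injEq, Prod.mk.injEq] at h'
      exact h'.1
  refine ⟨(σ, τ, ρ), ⟨hσ, fun i => hτ (σ i), hρ⟩, ?_⟩
  rintro ⟨σ', τ', ρ'⟩ ⟨h1, h2, h3⟩
  have hτ' : τ' = τ := funext fun i => hτu i _ <| by
    have h := h2 (σ'.symm i)
    simp only [rearrange, Function.comp_apply, Equiv.sumCongr_apply, Sum.map_inl,
      Equiv.prodShear_apply, Equiv.apply_symm_apply] at h
    exact h
  subst hτ'
  rw [hσu σ' h1, hρu ρ' h3]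

theorem card_isSortedArrangement {f m n : ℕ} (hn : n = f * 2 + m)
    [DecidablePred fun e : (Fin f × Fin 2) ⊕ Fin m ≃ Fin n => IsSortedArrangement e] :
    (univ.filter fun e : (Fin f × Fin 2) ⊕ Fin m ≃ Fin n => IsSortedArrangement e).card *
      (2 ^ f * f.factorial * m.factorial) = n.factorial := by
  have hcard : Fintype.card ((Fin f × Fin 2) ⊕ Fin m) = n := by simp [hn]
  have h := card_eq_card_filter_mul_of_existsUnique
    (fun e : (Fin f × Fin 2) ⊕ Fin m ≃ Fin n => IsSortedArrangement e)
    (fun k : Equiv.Perm (Fin f) × (Fin f → Equiv.Perm (Fin 2)) × Equiv.Perm (Fin m) =>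
      (rearrange k.1 k.2.1 k.2.2).symm.equivCongr (Equiv.refl _))
    (fun e => by
      simpa [Equiv.equivCongr] using existsUnique_isSortedArrangement_rearrange e e.injective)
  rw [Fintype.card_equiv (Fintype.equivFinOfCardEq hcard), hcard] at h
  rw [h]
  simp only [Fintype.card_prod, Fintype.card_perm, Fintype.card_pi, Fintype.card_fin,
    Finset.prod_const, Finset.card_univ, Nat.factorial_two]
  ring

theorem strictMono_fin_iff {k : ℕ} {α : Type*} [Preorder α] (g : Fin k → α) :
    StrictMono g ↔ ∀ i (h : i + 1 < k), g ⟨i, by omega⟩ < g ⟨i + 1, h⟩ := by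
  cases k with
  | zero => exact ⟨fun _ i h => by omega, fun _ a => a.elim0⟩
  | succ k =>
    rw [Fin.strictMono_iff_lt_succ]
    exact ⟨fun h i hi => h ⟨i, by omega⟩, fun h i => h i (by omega)⟩

/-- The enumeration of `f` pairs followed by `m` further points. -/
def pairsEquiv {f m n : ℕ} (hn : n = f * 2 + m) : (Fin f × Fin 2) ⊕ Fin m ≃ Fin n :=
  (Equiv.sumCongr finProdFinEquiv (Equiv.refl _)).trans (finSumFinEquiv.trans (finCongr hn.symm))

theorem pairsEquiv_inl {f m n : ℕ} (hn : n = f * 2 + m) (i : Fin f) (b : Fin 2) :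
    pairsEquiv hn (Sum.inl (i, b)) = ⟨2 * i + b, by omega⟩ := by
  ext
  simp [pairsEquiv, add_comm]

theorem pairsEquiv_inr {f m n : ℕ} (hn : n = f * 2 + m) (j : Fin m) :
    pairsEquiv hn (Sum.inr j) = ⟨2 * f + j, by omega⟩ := by
  ext
  simp [pairsEquiv, mul_comm]

theorem pimg_lt_pimg_iff {n : ℕ} (d : Equiv.Perm (Fin n)) {i j a b : ℕ} (ha : a < n) (hb : b < n)
    (hi : i - 1 = a) (hj : j - 1 = b) : pimg d i < pimg d j ↔ d⁻¹ ⟨a, ha⟩ < d⁻¹ ⟨b, hb⟩ := by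
  subst hi hj
  simp [pimg, ha, hb]

theorem mem_Hset_iff {f m n : ℕ} (hn : n = f * 2 + m) (d : Equiv.Perm (Fin n)) :
    d ∈ Hset n f ↔ IsSortedArrangement ((pairsEquiv hn).trans d⁻¹) := by
  simp only [Hset, mem_filter, mem_univ, true_and, IsSortedArrangement, Equiv.trans_apply,
    pairsEquiv_inl, pairsEquiv_inr, strictMono_fin_iff, mem_Icc]
  refine and_congr ⟨fun H i hi => ?_, fun H i hi => ?_⟩
    (and_congr ⟨fun H i b hb => ?_, fun H i hi => ?_⟩ ⟨fun H j hj => ?_, fun H j hj => ?_⟩)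
  · exact (pimg_lt_pimg_iff d _ _ (by simp; omega) (by simp)).1 (H (i + 1) (by omega))
  · obtain ⟨i, rfl⟩ : ∃ k, i = k + 1 := ⟨i - 1, by omega⟩
    exact (pimg_lt_pimg_iff d _ _ (by simp; omega) (by simp)).2 (H i (by omega))
  · obtain rfl : b = 0 := by omega
    exact (pimg_lt_pimg_iff d _ _ (by simp; omega) (by simp; omega)).1 (H (i + 1) (by omega))
  · obtain ⟨i, rfl⟩ : ∃ k, i = k + 1 := ⟨i - 1, by omega⟩
    exact (pimg_lt_pimg_iff d _ _ (by simp; omega) (by simp; omega)).2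
      (H ⟨i, by omega⟩ 0 (by omega))
  · exact (pimg_lt_pimg_iff d _ _ (by simp) (by simp; omega)).1 (H (2 * f + j + 1) (by omega))
  · obtain ⟨j, rfl⟩ : ∃ k, j = 2 * f + k + 1 := ⟨j - 2 * f - 1, by omega⟩
    exact (pimg_lt_pimg_iff d _ _ (by simp) (by simp; omega)).2 (H j (by omega))

/-- `|H_f(n)| = n!/(2^f · f! · (n-2f)!)`. -/
theorem statement6 (n f : ℕ) (h : 2 * f ≤ n) :
    (Hset n f).card =
      n.factorial / (2 ^ f * f.factorial * (n - 2 * f).factorial) := by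
  classical
  have hn : n = f * 2 + (n - 2 * f) := by omega
  have hcard : (Hset n f).card = (univ.filter
      fun e : (Fin f × Fin 2) ⊕ Fin (n - 2 * f) ≃ Fin n => IsSortedArrangement e).card := by
    refine Finset.card_equiv
      ((Equiv.inv _).trans ((pairsEquiv hn).symm.equivCongr (Equiv.refl _))) fun d => ?_
    rw [mem_Hset_iff hn, mem_filter]
    exact (and_iff_right (mem_univ _)).symm
  rw [hcard, ← card_isSortedArrangement hn, Nat.mul_div_cancel _ (by positivity)]

end BMWPaper
end
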